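/- For every non-degenerate ranking problem and every strictly increasing concave function g : ℝ → ℝ, if a ranking policy π maximizes the diversity D(π) over all ranking policies, then every ranking σ with π(σ) > 0 is Pareto efficient for the intents. -/

import Mathlib

open Finset

/-- A ranking problem in a two-sided market: finite nonempty sets of items, intents,
user groups; a partition of the items into item groups; group proportions; per-group
intent distributions; a nonnegative relevance function; and a nonnegative exposure
function on positions with positive total exposure. -/
structure RankingProblem where
  Item : Type
  Intent : Type
  UserGrp : Type
  ItemGrp : Type
  [itemFin : Fintype Item]
  [itemDec : DecidableEq Item]
  [intentFin : Fintype Intent]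
  [userFin : Fintype UserGrp]
  [itemGrpFin : Fintype ItemGrp]
  [itemGrpDec : DecidableEq ItemGrp]
  [itemNe : Nonempty Item]
  [intentNe : Nonempty Intent]
  [userNe : Nonempty UserGrp]
  /-- group proportion of each user group -/
  ρ : UserGrp → ℝ
  ρ_nonneg : ∀ g, 0 ≤ ρ g
  ρ_sum : ∑ g, ρ g = 1
  /-- the item group of each item; this partitions the items, each group being nonempty -/
  grp : Item → ItemGrp
  grp_surj : Function.Surjective grp
  /-- intent distribution of each user group -/
  intentDist : UserGrp → Intent → ℝ
  intentDist_nonneg : ∀ g i, 0 ≤ intentDist g i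
  intentDist_sum : ∀ g, ∑ i, intentDist g i = 1
  /-- relevance of each item to each intent -/
  rel : Item → Intent → ℝ
  rel_nonneg : ∀ d i, 0 ≤ rel d i
  /-- exposure of each position -/
  expo : Fin (Fintype.card Item) → ℝ
  expo_nonneg : ∀ n, 0 ≤ expo n
  expo_sum_pos : 0 < ∑ n, expo n

attribute [instance] RankingProblem.itemFin RankingProblem.itemDec
  RankingProblem.intentFin RankingProblem.userFin RankingProblem.itemGrpFin
  RankingProblem.itemGrpDec RankingProblem.itemNe RankingProblem.intentNe
  RankingProblem.userNe

namespace RankingProblem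

variable (P : RankingProblem)

/-- A ranking is a bijection from items onto positions. -/
abbrev Ranking := P.Item ≃ Fin (Fintype.card P.Item)

/-- The overall intent distribution I_U(i) = Σ_UG ρ_UG · I_UG(i). -/
noncomputable def overallIntent (i : P.Intent) : ℝ := ∑ g, P.ρ g * P.intentDist g i

/-- Utility of a ranking for an intent: U(σ|i) = Σ_d e(σ(d))·r(d,i). -/
noncomputable def intentUtil (σ : P.Ranking) (i : P.Intent) : ℝ :=
  ∑ d, P.expo (σ d) * P.rel d i

/-- A ranking policy: a (finitely supported) probability distribution over rankings. -/
def IsPolicy (π : P.Ranking → ℝ) : Prop := (∀ σ, 0 ≤ π σ) ∧ ∑ σ, π σ = 1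

/-- Utility of a policy for a user group. -/
noncomputable def groupUtil (π : P.Ranking → ℝ) (g : P.UserGrp) : ℝ :=
  ∑ σ, π σ * ∑ i, P.intentDist g i * P.intentUtil σ i

/-- Overall utility of a policy. -/
noncomputable def utility (π : P.Ranking → ℝ) : ℝ := ∑ g, P.ρ g * P.groupUtil π g

/-- Utility of a policy for an item group. -/
noncomputable def itemGroupUtil (π : P.Ranking → ℝ) (dg : P.ItemGrp) : ℝ :=
  ∑ σ, π σ * ∑ i, P.overallIntent i *
    ∑ d ∈ univ.filter (fun d => P.grp d = dg), P.expo (σ d) * P.rel d i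

/-- Average exposure of an item group under a policy. -/
noncomputable def groupExposure (π : P.Ranking → ℝ) (dg : P.ItemGrp) : ℝ :=
  (∑ σ, π σ * ∑ d ∈ univ.filter (fun d => P.grp d = dg), P.expo (σ d)) /
    (univ.filter (fun d => P.grp d = dg)).card

/-- Expected relevance of an item to the whole user population. -/
noncomputable def expRel (d : P.Item) : ℝ := ∑ i, P.overallIntent i * P.rel d i

/-- Non-degeneracy of a ranking problem. -/
def NonDegenerate : Prop :=
  (∀ g, 0 < P.ρ g) ∧ (∀ i, 0 < P.overallIntent i) ∧
    (∀ i, ∃ d, 0 < P.rel d i) ∧ (∀ dg, ∃ d, P.grp d = dg ∧ 0 < P.expRel d)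

/-- The amount of intent covered by a ranking. -/
noncomputable def coverage (σ : P.Ranking) : ℝ :=
  ∑ i ∈ univ.filter (fun i => 0 < P.intentUtil σ i), P.overallIntent i

instance : Nonempty P.Ranking := ⟨Fintype.equivFin P.Item⟩

/-- The maximum amount of intent coverable by any ranking. -/
noncomputable def maxCoverage : ℝ := ⨆ σ : P.Ranking, P.coverage σ

/-- Items are ranked by expected relevance within each item group under π. -/
def RankedByExpRel (π : P.Ranking → ℝ) : Prop :=
  ∀ σ, 0 < π σ → ∀ dm dn, P.grp dm = P.grp dn → P.expRel dn < P.expRel dm →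
    P.expo (σ dn) ≤ P.expo (σ dm)

/-- User fairness of a policy with respect to a concave increasing function f. -/
noncomputable def userFairness (f : ℝ → ℝ) (π : P.Ranking → ℝ) : ℝ :=
  ∑ g, P.ρ g * f (P.groupUtil π g)

/-- Diversity of a single ranking with respect to a concave increasing function g. -/
noncomputable def rankDiversity (gf : ℝ → ℝ) (σ : P.Ranking) : ℝ :=
  ∑ i, P.overallIntent i * gf (P.intentUtil σ i)

/-- Diversity of a policy. -/
noncomputable def diversity (gf : ℝ → ℝ) (π : P.Ranking → ℝ) : ℝ :=
  ∑ σ, π σ * P.rankDiversity gf σ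

/-- π maximizes the overall utility over all ranking policies. -/
def MaxUtil (π : P.Ranking → ℝ) : Prop :=
  P.IsPolicy π ∧ ∀ π', P.IsPolicy π' → P.utility π' ≤ P.utility π

/-- π maximizes user fairness over all ranking policies. -/
def MaxUF (f : ℝ → ℝ) (π : P.Ranking → ℝ) : Prop :=
  P.IsPolicy π ∧ ∀ π', P.IsPolicy π' → P.userFairness f π' ≤ P.userFairness f π

/-- π maximizes diversity over all ranking policies. -/
def MaxDiv (gf : ℝ → ℝ) (π : P.Ranking → ℝ) : Prop :=
  P.IsPolicy π ∧ ∀ π', P.IsPolicy π' → P.diversity gf π' ≤ P.diversity gf π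

/-- π satisfies the disparate treatment constraints with merit function M. -/
def SatDT (M : P.ItemGrp → ℝ) (π : P.Ranking → ℝ) : Prop :=
  ∀ dg1 dg2, P.groupExposure π dg1 / M dg1 = P.groupExposure π dg2 / M dg2

/-- π maximizes overall utility among policies satisfying the disparate treatment
constraints with merit function M. -/
def MaxUtilDT (M : P.ItemGrp → ℝ) (π : P.Ranking → ℝ) : Prop :=
  P.IsPolicy π ∧ P.SatDT M π ∧
    ∀ π', P.IsPolicy π' → P.SatDT M π' → P.utility π' ≤ P.utility π

/-- π dominates π' for the user groups. -/
def DominatesUsers (π π' : P.Ranking → ℝ) : Prop :=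
  (∀ g, P.groupUtil π' g ≤ P.groupUtil π g) ∧ ∃ g, P.groupUtil π' g < P.groupUtil π g

/-- π is Pareto efficient for the user groups. -/
def ParetoUsers (π : P.Ranking → ℝ) : Prop :=
  ¬ ∃ π', P.IsPolicy π' ∧ P.DominatesUsers π' π

/-- σ dominates σ' for the intents. -/
def DominatesIntents (σ σ' : P.Ranking) : Prop :=
  (∀ i, P.intentUtil σ' i ≤ P.intentUtil σ i) ∧ ∃ i, P.intentUtil σ' i < P.intentUtil σ i

/-- σ is Pareto efficient for the intents. -/
def ParetoIntents (σ : P.Ranking) : Prop := ¬ ∃ σ', P.DominatesIntents σ' σ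

end RankingProblem
/-- Every ranking in the support of a diversity-maximizing policy is Pareto efficient
for the intents. -/
theorem stmt19 (P : RankingProblem) (hP : P.NonDegenerate) (g : ℝ → ℝ)
    (hg : StrictMono g) (hg' : ConcaveOn ℝ Set.univ g)
    (π : P.Ranking → ℝ) (hπ : P.MaxDiv g π)
    (σ : P.Ranking) (hσ : 0 < π σ) : P.ParetoIntents σ := by
  classical
  rintro ⟨τ, hle, i₀, hlt⟩
  obtain ⟨⟨hnn, hsum⟩, hmax⟩ := hπ
  obtain ⟨-, hI, -, -⟩ := hP
  have hdiv : P.rankDiversity g σ < P.rankDiversity g τ := by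
    unfold RankingProblem.rankDiversity
    apply Finset.sum_lt_sum
    · intro i _
      exact mul_le_mul_of_nonneg_left (hg.monotone (hle i)) (hI i).le
    · exact ⟨i₀, Finset.mem_univ _, mul_lt_mul_of_pos_left (hg hlt) (hI i₀)⟩
  -- move the mass of `σ` onto `τ`
  have key := hmax
    (fun s => π s + ((if s = τ then π σ else 0) - (if s = σ then π σ else 0))) ⟨?_, ?_⟩
  · have hexp : P.diversity g
        (fun s => π s + ((if s = τ then π σ else 0) - (if s = σ then π σ else 0)))
        = P.diversity g π
          + (π σ * P.rankDiversity g τ - π σ * P.rankDiversity g σ) := by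
      simp [RankingProblem.diversity, add_mul, sub_mul, Finset.sum_add_distrib,
        Finset.sum_sub_distrib, ite_mul]
    have := mul_lt_mul_of_pos_left hdiv hσ
    rw [hexp] at key
    linarith
  · intro s
    have h1 := hnn s
    by_cases hs : s = σ
    · subst hs
      by_cases ht : s = τ <;> simp [ht] <;> first | exact hnn _ | (simpa using h1)
    · by_cases ht : s = τ <;> simp only [hs, ht, if_true, if_false] <;> grind
  · simp [Finset.sum_add_distrib, Finset.sum_sub_distrib, hsum]
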